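/- Every eigenvalue of the Parareal iteration matrix T = I − M_g^{-1} M_f (over ℂ) is zero; equivalently, the spectral radius of T is zero. -/

import Mathlib

/-- The `((N+1)d) × ((N+1)d)` block bidiagonal matrix with identity diagonal blocks,
first-subdiagonal blocks `−A`, and all other blocks zero. -/
def pararealBlockMatrix (d N : ℕ) (A : Matrix (Fin d) (Fin d) ℝ) :
    Matrix (Fin (N + 1) × Fin d) (Fin (N + 1) × Fin d) ℝ :=
  fun p q =>
    if (p.1 : ℕ) = (q.1 : ℕ) then (if p.2 = q.2 then 1 else 0)
    else if (p.1 : ℕ) = (q.1 : ℕ) + 1 then -A p.2 q.2 else 0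

/-- Multiplying a vector whose blocks before block `p.1` vanish by a block bidiagonal matrix
does not change its `p`-th entry. -/
theorem pararealBlockMatrix_map_mulVec_apply {K : Type*} [CommRing K] [Algebra ℝ K]
    {d N : ℕ} (A : Matrix (Fin d) (Fin d) ℝ) (v : Fin (N + 1) × Fin d → K)
    (p : Fin (N + 1) × Fin d) (hv : ∀ q : Fin (N + 1) × Fin d, q.1 < p.1 → v q = 0) :
    ((pararealBlockMatrix d N A).map (algebraMap ℝ K)).mulVec v p = v p := by
  rw [Matrix.mulVec, dotProduct, Finset.sum_eq_single p]
  · simp [pararealBlockMatrix]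
  · intro q _ hqp
    by_cases hlt : q.1 < p.1
    · rw [hv q hlt, mul_zero]
    · have hsub : ¬ (p.1 : ℕ) = (q.1 : ℕ) + 1 := by
        rw [Fin.lt_def] at hlt
        omega
      have hdiag : ¬ ((p.1 : ℕ) = (q.1 : ℕ) ∧ p.2 = q.2) := fun h =>
        hqp (Prod.ext (Fin.ext h.1.symm) h.2.symm)
      have hzero : pararealBlockMatrix d N A p q = 0 := by
        simp only [pararealBlockMatrix, if_neg hsub, ← ite_and, if_neg hdiag]
      rw [Matrix.map_apply, hzero, map_zero, zero_mul]
  · simp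

/-- A vector vanishes if each entry vanishes as soon as all preceding blocks do. -/
theorem eq_zero_of_forall_block {K : Type*} [Zero K] {d N : ℕ} {v : Fin (N + 1) × Fin d → K}
    (h : ∀ p, (∀ q : Fin (N + 1) × Fin d, q.1 < p.1 → v q = 0) → v p = 0) : v = 0 := by
  have key : ∀ (n : Fin (N + 1)) (i : Fin d), v (n, i) = 0 := by
    intro n
    induction n using WellFoundedLT.induction with
    | ind n ih => exact fun i => h (n, i) fun q hq => ih q.1 hq q.2
  exact funext fun p => key p.1 p.2

theorem isUnit_pararealBlockMatrix (d N : ℕ) (A : Matrix (Fin d) (Fin d) ℝ) :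
    IsUnit (pararealBlockMatrix d N A) := by
  rw [← Matrix.mulVec_injective_iff_isUnit]
  refine (injective_iff_map_eq_zero (pararealBlockMatrix d N A).mulVecLin).2 fun v hv => ?_
  refine eq_zero_of_forall_block fun p hp => ?_
  have happly := pararealBlockMatrix_map_mulVec_apply A v p hp
  rw [← happly]
  exact congrFun hv p

/-- Every eigenvalue of the Parareal iteration matrix `T = I − M_g⁻¹ M_f` (over `ℂ`)
is zero; equivalently, the spectral radius of `T` is zero. -/
theorem parareal_iteration_matrix_eigenvalues_zero
    (d N : ℕ) (hd : 1 ≤ d) (hN : 1 ≤ N)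
    (F G : Matrix (Fin d) (Fin d) ℝ) :
    ∀ (μ : ℂ) (v : Fin (N + 1) × Fin d → ℂ), v ≠ 0 →
      ((1 - (pararealBlockMatrix d N G)⁻¹ * pararealBlockMatrix d N F).map
          (algebraMap ℝ ℂ)).mulVec v = μ • v →
      μ = 0 := by
  intro μ v hv hT
  by_contra hμ
  refine hv (eq_zero_of_forall_block fun p hp => ?_)
  set Mf := pararealBlockMatrix d N F
  set Mg := pararealBlockMatrix d N G
  have hmul : Mg * (1 - Mg⁻¹ * Mf) = Mg - Mf := by
    rw [mul_sub, mul_one, Matrix.mul_nonsing_inv_cancel_left _ _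
      ((Matrix.isUnit_iff_isUnit_det _).1 (isUnit_pararealBlockMatrix d N G))]
  have heq := congrArg (fun w => (Mg.map (algebraMap ℝ ℂ)).mulVec w p) hT
  simp only [Matrix.mulVec_mulVec, ← Matrix.map_mul, hmul, Matrix.mulVec_smul] at heq
  rw [Matrix.map_sub _ (map_sub _), Matrix.sub_mulVec, Pi.sub_apply, Pi.smul_apply,
    pararealBlockMatrix_map_mulVec_apply G v p hp,
    pararealBlockMatrix_map_mulVec_apply F v p hp, sub_self, smul_eq_mul] at heq
  exact (mul_eq_zero.1 heq.symm).resolve_left hμ
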